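/- Let (G, ε) be a signed group with G finite. Then there does not exist a signed group orthogonal design SOD(6; 3, 3) over (G, ε). -/

import Mathlib

/-- A signed group: a group `G` together with a distinguished central element `ε`
of order two. -/
structure SignedGroup where
  /-- the underlying group -/
  G : Type
  /-- the group structure -/
  grp : Group G
  /-- the distinguished central element -/
  ε : G
  central : ∀ g : G, ε * g = g * ε
  sq : ε * ε = 1
  ne_one : ε ≠ 1

attribute [instance] SignedGroup.grp

namespace SignedGroup

/-- The number of columns `j` in row `a` whose entry is the variable `x i`
(with some signed-group coefficient). -/
noncomputable def rowCount (S : SignedGroup) {n k : ℕ} (X : Fin n → Fin n → Option (S.G × Fin k))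
    (a : Fin n) (i : Fin k) : ℕ :=
  Nat.card {j : Fin n // ∃ g : S.G, X a j = some (g, i)}

/-- `pairCount S X a b i i' g` is the number of columns `j` for which
`X a j = some (s, i)` and `X b j = some (s', i')` with `s * s'⁻¹ = g`. -/
noncomputable def pairCount (S : SignedGroup) {n k : ℕ} (X : Fin n → Fin n → Option (S.G × Fin k))
    (a b : Fin n) (i i' : Fin k) (g : S.G) : ℕ :=
  Nat.card {j : Fin n //
    ∃ s s' : S.G, X a j = some (s, i) ∧ X b j = some (s', i') ∧ s * s'⁻¹ = g}

/-- `X` is a signed group orthogonal design `SOD(n; u 0, …, u (k-1))` over `S`. -/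
def IsSOD (S : SignedGroup) {n k : ℕ} (u : Fin k → ℕ)
    (X : Fin n → Fin n → Option (S.G × Fin k)) : Prop :=
  (∀ (a : Fin n) (i : Fin k), S.rowCount X a i = u i) ∧
  (∀ a b : Fin n, a ≠ b → ∀ (i i' : Fin k) (g : S.G),
    S.pairCount X a b i i' g + S.pairCount X a b i' i g =
      S.pairCount X a b i i' (S.ε * g) + S.pairCount X a b i' i (S.ε * g))

/-- An SOD is full if it has no zero entries. -/
def IsFull (S : SignedGroup) {n k : ℕ} (X : Fin n → Fin n → Option (S.G × Fin k)) : Prop :=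
  ∀ a b : Fin n, X a b ≠ none

end SignedGroup

/-- Six subsets of size three of a six-element set cannot have pairwise intersections of even
size. -/
theorem not_even_card_inter_of_card_eq_three (T : Fin 6 → Finset (Fin 6))
    (hT : ∀ a, (T a).card = 3) (heven : ∀ a b, a ≠ b → Even (T a ∩ T b).card) : False := by
  -- Two disjoint triples would be complementary, so a further triple would have odd size.
  have hpos (a b : Fin 6) (hab : a ≠ b) : (T a ∩ T b).card ≠ 0 := by
    intro h0
    have hdisj : Disjoint (T a) (T b) :=
      Finset.disjoint_iff_inter_eq_empty.mpr (Finset.card_eq_zero.mp h0)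
    have huniv : T a ∪ T b = Finset.univ := by
      rw [← Finset.card_eq_iff_eq_univ, Finset.card_union_of_disjoint hdisj, hT, hT]
      rfl
    obtain ⟨c, hca, hcb⟩ : ∃ c : Fin 6, c ≠ a ∧ c ≠ b :=
      (by decide : ∀ a b : Fin 6, ∃ c, c ≠ a ∧ c ≠ b) a b
    have hsum : (T c ∩ T a).card + (T c ∩ T b).card = 3 := by
      rw [← Finset.card_union_of_disjoint
        (hdisj.mono Finset.inter_subset_right Finset.inter_subset_right),
        ← Finset.inter_union_distrib_left, huniv, Finset.inter_univ, hT]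
    have := hsum ▸ (heven c a hca).add (heven c b hcb)
    exact absurd this (by decide)
  have htwo (a b : Fin 6) (hab : a ≠ b) : (T a ∩ T b).card = 2 := by
    have hle : (T a ∩ T b).card ≤ 3 := hT a ▸ Finset.card_le_card Finset.inter_subset_left
    obtain ⟨m, hm⟩ := heven a b hab
    have := hpos a b hab
    omega
  -- The Gram matrix of the incidence vectors is `1 + 2J`, whose determinant is not a square.
  let M : Matrix (Fin 6) (Fin 6) ℤ := Matrix.of fun a j ↦ if j ∈ T a then 1 else 0
  have hgram : M * M.transpose = 1 + Matrix.replicateCol Unit (fun _ : Fin 6 ↦ (2 : ℤ)) *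
      Matrix.replicateRow Unit (fun _ : Fin 6 ↦ (1 : ℤ)) := by
    ext a b
    have hentry : (M * M.transpose) a b = ((T a ∩ T b).card : ℤ) := by
      simp [M, Matrix.mul_apply, ← ite_and, ← Finset.mem_inter, Finset.inter_comm]
    rw [hentry]
    by_cases hab : a = b
    · subst hab
      simp [hT, Matrix.mul_apply]
    · simp [htwo a b hab, hab, Matrix.mul_apply]
  have hdet : M.det * M.det = 13 := by
    have := congrArg Matrix.det hgram
    rw [Matrix.det_mul, Matrix.det_transpose,
      Matrix.det_one_add_replicateCol_mul_replicateRow] at this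
    simpa [dotProduct] using this
  have hlt : |M.det| < 4 := by
    apply abs_lt_of_sq_lt_sq <;> linarith
  rw [abs_lt] at hlt
  obtain ⟨hlo, hhi⟩ := hlt
  generalize M.det = d at *
  interval_cases d <;> omega

namespace SignedGroup

/-- The columns of row `a` whose entry involves the variable `x i`. -/
noncomputable def rowSupport (S : SignedGroup) {n k : ℕ} (X : Fin n → Fin n → Option (S.G × Fin k))
    (i : Fin k) (a : Fin n) : Finset (Fin n) :=
  open scoped Classical in Finset.univ.filter fun j ↦ ∃ g : S.G, X a j = some (g, i)

theorem card_rowSupport (S : SignedGroup) {n k : ℕ} (X : Fin n → Fin n → Option (S.G × Fin k))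
    (i : Fin k) (a : Fin n) : (S.rowSupport X i a).card = S.rowCount X a i := by
  classical
  rw [rowCount, Nat.card_eq_fintype_card, Fintype.card_subtype, rowSupport]

/-- The columns in which two rows both involve `x i` are partitioned by the quotients of the
coefficients. -/
theorem card_rowSupport_inter (S : SignedGroup) [Fintype S.G] {n k : ℕ}
    (X : Fin n → Fin n → Option (S.G × Fin k)) (i : Fin k) (a b : Fin n) :
    (S.rowSupport X i a ∩ S.rowSupport X i b).card = ∑ g : S.G, S.pairCount X a b i i g := by
  classical
  have hunion : S.rowSupport X i a ∩ S.rowSupport X i b = Finset.univ.biUnion fun g : S.G ↦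
      Finset.univ.filter fun j ↦
        ∃ s s' : S.G, X a j = some (s, i) ∧ X b j = some (s', i) ∧ s * s'⁻¹ = g := by
    ext j
    simp [rowSupport]
  rw [hunion, Finset.card_biUnion]
  · exact Finset.sum_congr rfl fun g _ ↦ by
      rw [pairCount, Nat.card_eq_fintype_card, Fintype.card_subtype]
  · intro g _ h _ hgh
    refine Finset.disjoint_filter.mpr ?_
    rintro j - ⟨s, s', hs, hs', rfl⟩ ⟨t, t', ht, ht', rfl⟩
    simp_all

/-- A function on a finite signed group invariant under multiplication by `ε` has even sum. -/
theorem even_sum_of_eps_mul (S : SignedGroup) [Fintype S.G] (f : S.G → ℕ)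
    (hf : ∀ g, f g = f (S.ε * g)) : Even (∑ g, f g) := by
  rw [← ZMod.natCast_eq_zero_iff_even, Nat.cast_sum]
  refine Finset.sum_involution (fun g _ ↦ S.ε * g) (fun g _ ↦ ?_) (fun g _ _ h ↦ ?_)
    (fun _ _ ↦ Finset.mem_univ _) (fun g _ ↦ ?_)
  · rw [← hf, CharTwo.add_self_eq_zero]
  · exact S.ne_one (mul_eq_right.mp h)
  · rw [← mul_assoc, S.sq, one_mul]

theorem IsSOD.even_card_rowSupport_inter {S : SignedGroup} [Finite S.G] {n k : ℕ} {u : Fin k → ℕ}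
    {X : Fin n → Fin n → Option (S.G × Fin k)} (hX : S.IsSOD u X) (i : Fin k) {a b : Fin n}
    (hab : a ≠ b) : Even (S.rowSupport X i a ∩ S.rowSupport X i b).card := by
  have := Fintype.ofFinite S.G
  rw [card_rowSupport_inter]
  refine S.even_sum_of_eps_mul _ fun g ↦ ?_
  have := hX.2 a b hab i i g
  omega

end SignedGroup

/-- There does not exist any `SOD(6; 3, 3)` over a finite signed group. -/
theorem no_SOD_6_3_3 (S : SignedGroup) (hG : Finite S.G) :
    ¬ ∃ X : Fin 6 → Fin 6 → Option (S.G × Fin 2), S.IsSOD ![3, 3] X := by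
  rintro ⟨X, hX⟩
  exact not_even_card_inter_of_card_eq_three (S.rowSupport X 0)
    (fun a ↦ (S.card_rowSupport X 0 a).trans (hX.1 a 0))
    fun _ _ hab ↦ hX.even_card_rowSupport_inter 0 hab
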